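/- The contraction of the field strength with the Chern–Simons Euler–Lagrange expressions vanishes identically (the trivial Noether identity ℱ^r_{λμ}·E^λ_r = 0 noted by the paper): for every μ ∈ Fin 3, Σ_{r,λ} ℱ^r_{λμ} · E^λ_r = 0 in R, where ℱ^r_{λμ} := d_μ(a^r_λ) − d_λ(a^r_μ) − Σ_{p,q} c^r_{pq} · a^p_λ · a^q_μ. -/

import Mathlib

/-- Size `|Λ|` of a multi-index. -/
def msize {n : ℕ} (Λ : Fin n →₀ ℕ) : ℕ := ∑ i, Λ i

/-- Iterated derivative `d_Λ = ∏ λ (d λ)^[Λ λ]` (well defined for commuting `d λ`). -/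
def dIter {R : Type*} {n : ℕ} (d : Fin n → R → R) (Λ : Fin n →₀ ℕ) : R → R :=
  (List.finRange n).foldr (fun i acc => (d i)^[Λ i] ∘ acc) id

/-- The total derivative `d_λ` on `MvPolynomial (ι × M) k`, the unique `k`-derivation
with `d_λ (X (i, Λ)) = X (i, Λ + e_λ)`. -/
noncomputable def totalDeriv (k : Type*) [CommRing k] {n : ℕ} (ι : Type*) (l : Fin n) :
    Derivation k (MvPolynomial (ι × (Fin n →₀ ℕ)) k) (MvPolynomial (ι × (Fin n →₀ ℕ)) k) :=
  MvPolynomial.mkDerivation k fun p => MvPolynomial.X (p.1, p.2 + Finsupp.single l 1)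

/-- The Euler–Lagrange derivative `E_i (L) = ∑_Λ (-1)^{|Λ|} d_Λ (∂_{(i,Λ)} L)`. -/
noncomputable def EL (k : Type*) [CommRing k] {n : ℕ} (ι : Type*) (i : ι)
    (L : MvPolynomial (ι × (Fin n →₀ ℕ)) k) : MvPolynomial (ι × (Fin n →₀ ℕ)) k :=
  ∑ᶠ Λ : Fin n →₀ ℕ, (-1 : MvPolynomial (ι × (Fin n →₀ ℕ)) k) ^ msize Λ *
    dIter (fun l => ⇑(totalDeriv k ι l)) Λ (MvPolynomial.pderiv (i, Λ) L)

/-- The Levi–Civita sign `ε^{αβγ}` on `Fin 3`. -/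
def eps (α β γ : Fin 3) : ℝ :=
  if (α, β, γ) = (0, 1, 2) ∨ (α, β, γ) = (1, 2, 0) ∨ (α, β, γ) = (2, 0, 1) then 1
  else if (α, β, γ) = (0, 2, 1) ∨ (α, β, γ) = (2, 1, 0) ∨ (α, β, γ) = (1, 0, 2) then -1
  else 0

/-- The gauge-potential variable `a^r_λ = X ((r, λ), 0)`. -/
noncomputable def aVar (N : ℕ) (r : Fin N) (l : Fin 3) :
    MvPolynomial ((Fin N × Fin 3) × (Fin 3 →₀ ℕ)) ℝ :=
  MvPolynomial.X ((r, l), 0)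

/-- The local Chern–Simons Lagrangian. -/
noncomputable def LCS (N : ℕ) (c : Fin N → Fin N → Fin N → ℝ) (a : Fin N → Fin N → ℝ) :
    MvPolynomial ((Fin N × Fin 3) × (Fin 3 →₀ ℕ)) ℝ :=
  (∑ m, ∑ n', ∑ α, ∑ β, ∑ γ, MvPolynomial.C (a m n' * eps α β γ) *
      (aVar N m α * totalDeriv ℝ (Fin N × Fin 3) γ (aVar N n' β)))
    - MvPolynomial.C (1 / 3 : ℝ) *
        ∑ m, ∑ n', ∑ p, ∑ q, ∑ α, ∑ β, ∑ γ,
          MvPolynomial.C (eps α β γ * a m n' * c n' p q) *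
            (aVar N m α * aVar N p β * aVar N q γ)

/-- The Euler–Lagrange expression `E^λ_q` of the local Chern–Simons Lagrangian. -/
noncomputable def ELCS (N : ℕ) (c : Fin N → Fin N → Fin N → ℝ) (a : Fin N → Fin N → ℝ)
    (q : Fin N) (l : Fin 3) : MvPolynomial ((Fin N × Fin 3) × (Fin 3 →₀ ℕ)) ℝ :=
  EL ℝ (Fin N × Fin 3) (q, l) (LCS N c a)

/-- The field strength `ℱ^r_{λμ} = d_μ(a^r_λ) - d_λ(a^r_μ) - ∑_{p,q} c^r_{pq} a^p_λ a^q_μ`. -/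
noncomputable def calF (N : ℕ) (c : Fin N → Fin N → Fin N → ℝ) (r : Fin N) (l μ : Fin 3) :
    MvPolynomial ((Fin N × Fin 3) × (Fin 3 →₀ ℕ)) ℝ :=
  totalDeriv ℝ (Fin N × Fin 3) μ (aVar N r l) - totalDeriv ℝ (Fin N × Fin 3) l (aVar N r μ)
    - ∑ p, ∑ q, MvPolynomial.C (c r p q) * (aVar N p l * aVar N q μ)


open MvPolynomial

lemma eps_swap (α β γ : Fin 3) : eps α β γ = - eps β α γ := by
  fin_cases α <;> fin_cases β <;> fin_cases γ <;> simp [eps]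

lemma eps_swap_right (α β γ : Fin 3) : eps α β γ = - eps α γ β := by
  fin_cases α <;> fin_cases β <;> fin_cases γ <;> simp [eps]

lemma calF_anti (N : ℕ) (c : Fin N → Fin N → Fin N → ℝ)
    (hc : ∀ r p q, c r p q = - c r q p) (r : Fin N) (l μ : Fin 3) :
    calF N c r l μ = - calF N c r μ l := by
  have h : ∑ p, ∑ q, C (c r p q) * (aVar N p l * aVar N q μ)
      = - ∑ p, ∑ q, C (c r p q) * (aVar N p μ * aVar N q l) := by
    rw [Finset.sum_comm, ← Finset.sum_neg_distrib]
    refine Finset.sum_congr rfl fun p _ => ?_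
    rw [← Finset.sum_neg_distrib]
    refine Finset.sum_congr rfl fun q _ => ?_
    rw [hc r q p, C_neg]; ring
  unfold calF
  rw [h]; ring

lemma contract_aux (N : ℕ) (a : Fin N → Fin N → ℝ) (ha : ∀ m n', a m n' = a n' m)
    {R : Type*} [CommRing R] [Algebra ℝ R] (F : Fin N → Fin 3 → Fin 3 → R)
    (hF : ∀ r l m, F r l m = - F r m l) (μ : Fin 3) :
    ∑ r, ∑ l, F r l μ * ∑ n, algebraMap ℝ R (a r n) *
      ∑ β, ∑ γ, algebraMap ℝ R (eps l β γ) * F n β γ = 0 := by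
  have key : ∀ u v : Fin N → R, ∑ r, ∑ n, algebraMap ℝ R (a r n) * (u r * v n)
      = ∑ r, ∑ n, algebraMap ℝ R (a r n) * (v r * u n) := by
    intro u v
    rw [Finset.sum_comm]
    refine Finset.sum_congr rfl fun p _ => Finset.sum_congr rfl fun q _ => ?_
    rw [ha q p]; ring
  have h1 : ∀ r, ∑ l, F r l μ * ∑ n, algebraMap ℝ R (a r n) *
      (∑ β, ∑ γ, algebraMap ℝ R (eps l β γ) * F n β γ)
      = ∑ n, algebraMap ℝ R (a r n) *
        (F r 0 μ * (2 * F n 1 2) + F r 1 μ * (2 * F n 2 0) + F r 2 μ * (2 * F n 0 1)) := by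
    intro r
    simp_rw [Finset.mul_sum]
    rw [Finset.sum_comm]
    refine Finset.sum_congr rfl fun n _ => ?_
    simp [Fin.sum_univ_three, eps]
    rw [hF n 2 1, hF n 1 0, hF n 0 2]; ring
  have h0 : ∀ r l, F r l l = 0 := by
    intro r l
    have h := hF r l l
    have h2 : (2:ℝ) • F r l l = 0 := by
      rw [two_smul]; nth_rewrite 1 [h]; ring
    have := congrArg (fun x => (2⁻¹:ℝ) • x) h2
    simpa [smul_smul] using this
  simp_rw [h1]
  have k1 := key (fun r => F r 0 1) (fun r => 2 * F r 1 2)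
  have k2 := key (fun r => F r 1 2) (fun r => 2 * F r 2 0)
  have k3 := key (fun r => F r 2 0) (fun r => 2 * F r 0 1)
  rw [← sub_eq_zero] at k1 k2 k3
  simp_rw [← Finset.sum_sub_distrib] at k1 k2 k3
  fin_cases μ
  · rw [← k3]
    refine Finset.sum_congr rfl fun p _ => Finset.sum_congr rfl fun q _ => ?_
    simp only [Fin.zero_eta, h0, hF p 1 0]; ring
  · rw [← k1]
    refine Finset.sum_congr rfl fun p _ => Finset.sum_congr rfl fun q _ => ?_
    simp only [Fin.mk_one, h0, hF p 2 1]; ring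
  · rw [← k2]
    refine Finset.sum_congr rfl fun p _ => Finset.sum_congr rfl fun q _ => ?_
    simp only [Fin.reduceFinMk, h0, hF p 0 2]; ring

/-- the cubic coefficient with lowered index -/
noncomputable def lowK (N : ℕ) (c : Fin N → Fin N → Fin N → ℝ) (a : Fin N → Fin N → ℝ)
    (m p q : Fin N) : ℝ := ∑ n, a m n * c n p q

lemma lowK_right (N : ℕ) (c : Fin N → Fin N → Fin N → ℝ) (a : Fin N → Fin N → ℝ)
    (hc : ∀ r p q, c r p q = - c r q p) (m p q : Fin N) :
    lowK N c a m p q = - lowK N c a m q p := by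
  unfold lowK
  rw [← Finset.sum_neg_distrib]
  refine Finset.sum_congr rfl fun n _ => ?_
  rw [hc]; ring

lemma lowK_swap (N : ℕ) (c : Fin N → Fin N → Fin N → ℝ) (a : Fin N → Fin N → ℝ)
    (hc : ∀ r p q, c r p q = - c r q p) (ha : ∀ m n', a m n' = a n' m)
    (hinv : ∀ p m n', ∑ s, (c s p m * a s n' + c s p n' * a m s) = 0) (m p q : Fin N) :
    lowK N c a m p q = - lowK N c a p m q := by
  have h := hinv q m p
  have h2 : lowK N c a p q m + lowK N c a m q p = 0 := by
    rw [← h]; unfold lowK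
    rw [← Finset.sum_add_distrib]
    refine Finset.sum_congr rfl fun n _ => ?_
    rw [ha p n]; ring
  rw [lowK_right N c a hc m, lowK_right N c a hc p]
  linarith

lemma LCS_eq (N : ℕ) (c : Fin N → Fin N → Fin N → ℝ) (a : Fin N → Fin N → ℝ) :
    LCS N c a = (∑ m, ∑ n', ∑ α, ∑ β, ∑ γ, C (a m n' * eps α β γ) *
      (X ((m, α), 0) * X ((n', β), Finsupp.single γ 1)))
    - C (1 / 3 : ℝ) *
        ∑ m, ∑ p, ∑ q, ∑ α, ∑ β, ∑ γ,
          C (eps α β γ * lowK N c a m p q) *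
            (X ((m, α), 0) * X ((p, β), 0) * X ((q, γ), 0)) := by
  unfold LCS aVar totalDeriv
  refine congrArg₂ (· - ·) ?_ (congrArg₂ (· * ·) rfl ?_)
  · simp only [mkDerivation_X, zero_add]
  · refine Finset.sum_congr rfl fun m _ => ?_
    rw [Finset.sum_comm]
    refine Finset.sum_congr rfl fun p _ => ?_
    rw [Finset.sum_comm]
    refine Finset.sum_congr rfl fun q _ => ?_
    rw [Finset.sum_comm]
    refine Finset.sum_congr rfl fun α _ => ?_
    rw [Finset.sum_comm]
    refine Finset.sum_congr rfl fun β _ => ?_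
    rw [Finset.sum_comm]
    refine Finset.sum_congr rfl fun γ _ => ?_
    rw [← Finset.sum_mul, ← map_sum, lowK, Finset.mul_sum]
    simp only [mul_assoc]

lemma sum_rot {R ι κ τ : Type*} [AddCommMonoid R] [Fintype ι] [Fintype κ] [Fintype τ]
    (f : ι → κ → τ → R) : ∑ x, ∑ y, ∑ n, f x y n = ∑ n, ∑ x, ∑ y, f x y n := by
  rw [Finset.sum_comm (s := (Finset.univ : Finset τ))]
  exact Finset.sum_congr rfl fun x _ => Finset.sum_comm

lemma sum_reorder {R ι κ : Type*} [AddCommMonoid R] [Fintype ι] [Fintype κ]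
    (f : ι → κ → κ → ι → ι → R) :
    ∑ p, ∑ s, ∑ β, ∑ γ, ∑ n, f n β γ p s = ∑ n, ∑ β, ∑ γ, ∑ p, ∑ s, f n β γ p s := by
  have h : ∀ p s, ∑ β, ∑ γ, ∑ n, f n β γ p s = ∑ n, ∑ β, ∑ γ, f n β γ p s :=
    fun p s => sum_rot _
  simp only [h]
  rw [sum_rot (fun p s n => ∑ β, ∑ γ, f n β γ p s)]
  refine Finset.sum_congr rfl fun n _ => ?_
  rw [sum_rot (fun β γ p => ∑ s, f n β γ p s)]
  exact Finset.sum_congr rfl fun p _ => (sum_rot (fun β γ s => f n β γ p s)).symm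

section
variable (N : ℕ) (c : Fin N → Fin N → Fin N → ℝ) (a : Fin N → Fin N → ℝ)
  (q : Fin N) (l : Fin 3)

lemma pd_X (N : ℕ) (q m : Fin N) (l α : Fin 3) (Λ Λ' : Fin 3 →₀ ℕ) :
    pderiv ((q, l), Λ) (X ((m, α), Λ') : MvPolynomial ((Fin N × Fin 3) × (Fin 3 →₀ ℕ)) ℝ)
    = if m = q then (if α = l then (if Λ' = Λ then 1 else 0) else 0) else 0 := by
  classical
  rw [pderiv_X, Pi.single_apply]
  simp only [Prod.mk.injEq]
  split_ifs <;> simp_all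

lemma pderiv_other (Λ : Fin 3 →₀ ℕ) (h0 : Λ ≠ 0) (h1 : ∀ γ, Λ ≠ Finsupp.single γ 1) :
    pderiv ((q, l), Λ) (LCS N c a) = 0 := by
  have h1' : ∀ γ, ¬ (Finsupp.single γ 1 = Λ) := fun γ h => h1 γ h.symm
  have h0' : ¬ (0 = Λ) := fun h => h0 h.symm
  rw [LCS_eq]
  simp [Derivation.leibniz, pd_X, h1', h0']

lemma pderiv_single (γ : Fin 3) :
    pderiv ((q, l), Finsupp.single γ 1) (LCS N c a)
      = ∑ m, ∑ α, C (a m q * eps α l γ) * aVar N m α := by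
  have h0' : ¬ ((0 : Fin 3 →₀ ℕ) = Finsupp.single γ 1) := by
    intro h; simpa using (congrArg (fun f => f γ) h)
  have h1 : ∀ γ' : Fin 3, ((Finsupp.single γ' 1 : Fin 3 →₀ ℕ) = Finsupp.single γ 1) ↔ γ' = γ := by
    intro γ'; exact (Finsupp.single_left_injective one_ne_zero).eq_iff
  rw [LCS_eq]
  simp only [map_sum, map_sub, Derivation.leibniz, pd_X, h0', h1, pderiv_C, smul_zero,
    if_false, ite_self, add_zero, Finset.sum_const_zero, sub_zero, smul_eq_mul, mul_ite, mul_one, mul_zero, Finset.sum_ite_eq', Finset.mem_univ, if_true, aVar, Finset.sum_ite_irrel]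

lemma pderiv_zero (hc : ∀ r p q, c r p q = - c r q p) (ha : ∀ m n', a m n' = a n' m)
    (hinv : ∀ p m n', ∑ s, (c s p m * a s n' + c s p n' * a m s) = 0) :
    pderiv ((q, l), 0) (LCS N c a)
      = (∑ n, ∑ β, ∑ γ, C (a q n * eps l β γ) * totalDeriv ℝ (Fin N × Fin 3) γ (aVar N n β))
       - ∑ p, ∑ s, ∑ β, ∑ γ, C (eps l β γ * lowK N c a q p s) * (aVar N p β * aVar N s γ) := by
  have h1 : ∀ γ' : Fin 3, ¬ ((Finsupp.single γ' 1 : Fin 3 →₀ ℕ) = 0) := by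
    intro γ'; simp [Finsupp.single_eq_zero]
  rw [LCS_eq, map_sub]
  refine congrArg₂ (· - ·) ?_ ?_
  · simp only [map_sum, Derivation.leibniz, pd_X, h1, pderiv_C, smul_zero, if_true,
      if_false, ite_self, add_zero, zero_add, Finset.sum_const_zero, smul_eq_mul, mul_ite,
      mul_one, mul_zero, Finset.sum_ite_eq', Finset.mem_univ, Finset.sum_ite_irrel, aVar,
      totalDeriv, mkDerivation_X]
  · have h3 : ∀ x : MvPolynomial ((Fin N × Fin 3) × (Fin 3 →₀ ℕ)) ℝ,
        x = C (1 / 3 : ℝ) * (x + x + x) := by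
      intro x
      have : (C (1 / 3 : ℝ) : MvPolynomial ((Fin N × Fin 3) × (Fin 3 →₀ ℕ)) ℝ) * 3 = 1 := by
        rw [← map_ofNat C 3, ← C_mul]; norm_num
      linear_combination (-x) * this
    refine Eq.trans ?_ (h3 _).symm
    rw [Derivation.leibniz, pderiv_C, smul_zero, add_zero, smul_eq_mul]
    refine congrArg₂ (· * ·) rfl ?_
    simp only [map_sum, Derivation.leibniz, pd_X, pderiv_C, smul_zero, if_true,
      add_zero, Finset.sum_const_zero, smul_eq_mul, mul_ite, mul_add, Finset.sum_add_distrib,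
      mul_one, mul_zero, Finset.sum_ite_eq', Finset.mem_univ, Finset.sum_ite_irrel, aVar]
    have e2 : ∀ m s α γ, eps α l γ * lowK N c a m q s = eps l α γ * lowK N c a q m s := by
      intro m s α γ
      rw [eps_swap, lowK_swap N c a hc ha hinv m]; ring
    have e3 : ∀ m s α γ, eps α γ l * lowK N c a m s q = eps l α γ * lowK N c a q m s := by
      intro m s α γ
      rw [eps_swap_right, lowK_right N c a hc m, ← e2]; ring
    simp only [e2, e3]
    have e4 : ∀ f : Fin N → Fin N → Fin 3 → Fin 3 →
        MvPolynomial ((Fin N × Fin 3) × (Fin 3 →₀ ℕ)) ℝ,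
        ∑ p, ∑ s, ∑ β, ∑ γ, f p s β γ * (X ((s, γ), 0) * X ((p, β), 0))
        = ∑ p, ∑ s, ∑ β, ∑ γ, f p s β γ * (X ((p, β), 0) * X ((s, γ), 0)) := by
      intro f
      refine Finset.sum_congr rfl fun p _ => Finset.sum_congr rfl fun s _ =>
        Finset.sum_congr rfl fun β _ => Finset.sum_congr rfl fun γ _ => ?_
      ring
    have e5 := e4 (fun p s β γ => C (eps l β γ * lowK N c a q p s))
    ring_nf at e5 ⊢
    linear_combination 2 * e5

lemma ELCS_eq (hc : ∀ r p q, c r p q = - c r q p) (ha : ∀ m n', a m n' = a n' m)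
    (hinv : ∀ p m n', ∑ s, (c s p m * a s n' + c s p n' * a m s) = 0) :
    ELCS N c a q l = pderiv ((q, l), 0) (LCS N c a)
     - ∑ γ, totalDeriv ℝ (Fin N × Fin 3) γ (pderiv ((q, l), Finsupp.single γ 1) (LCS N c a)) := by
  classical
  unfold ELCS EL
  have hinj : Function.Injective (fun γ : Fin 3 => (Finsupp.single γ 1 : Fin 3 →₀ ℕ)) :=
    Finsupp.single_left_injective one_ne_zero
  have hd : ∀ (d : Fin 3 → MvPolynomial ((Fin N × Fin 3) × (Fin 3 →₀ ℕ)) ℝ →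
      MvPolynomial ((Fin N × Fin 3) × (Fin 3 →₀ ℕ)) ℝ) Λ, 
      dIter d Λ = (d 0)^[Λ 0] ∘ (d 1)^[Λ 1] ∘ (d 2)^[Λ 2] := by
    intro d Λ; simp [dIter, List.finRange_succ]
  rw [finsum_eq_sum_of_support_subset (s := insert 0 (Finset.univ.image (fun γ : Fin 3 => (Finsupp.single γ 1 : Fin 3 →₀ ℕ))))]
  · rw [Finset.sum_insert (by simp [Finsupp.single_eq_zero]), Finset.sum_image (fun x _ y _ h => hinj h), sub_eq_add_neg, ← Finset.sum_neg_distrib]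
    congr 1
    · simp [hd, msize]
    · refine Finset.sum_congr rfl fun γ _ => ?_
      fin_cases γ <;> simp [hd, msize, Fin.sum_univ_three]
  · intro Λ hΛ
    by_contra hcon
    apply hΛ
    simp only [Finset.coe_insert, Finset.coe_image, Set.mem_insert_iff, not_or, Finset.coe_univ, Set.image_univ, Set.mem_range, not_exists] at hcon
    have := pderiv_other N c a q l Λ hcon.1 (fun γ h => hcon.2 γ h.symm)
    simp only [this, hd]
    have hz : ∀ (l : Fin 3) n, (⇑(totalDeriv ℝ (Fin N × Fin 3) l))^[n] 0 = 0 := by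
      intro l n; exact Function.iterate_fixed (map_zero _) n
    simp [hz]

lemma ELCS_calF (hc : ∀ r p q, c r p q = - c r q p) (ha : ∀ m n', a m n' = a n' m)
    (hinv : ∀ p m n', ∑ s, (c s p m * a s n' + c s p n' * a m s) = 0) :
    ELCS N c a q l = ∑ n, C (a q n) * ∑ β, ∑ γ, C (eps l β γ) * calF N c n β γ := by
  rw [ELCS_eq N c a q l hc ha hinv, pderiv_zero N c a q l hc ha hinv]
  simp only [pderiv_single]
  have hA : ∑ γ, totalDeriv ℝ (Fin N × Fin 3) γ (∑ m, ∑ α, C (a m q * eps α l γ) * aVar N m α)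
      = ∑ n, C (a q n) * ∑ β, ∑ γ, C (- eps l β γ) *
          totalDeriv ℝ (Fin N × Fin 3) γ (aVar N n β) := by
    simp only [map_sum, Derivation.leibniz, smul_eq_mul]
    rw [Finset.sum_comm]
    refine Finset.sum_congr rfl fun n _ => ?_
    rw [Finset.sum_comm, Finset.mul_sum]
    refine Finset.sum_congr rfl fun β _ => ?_
    rw [Finset.mul_sum]
    refine Finset.sum_congr rfl fun γ _ => ?_
    have : totalDeriv ℝ (Fin N × Fin 3) γ (C (a n q * eps β l γ)) = 0 := by
      exact Derivation.map_algebraMap _ _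
    rw [this, mul_zero, add_zero, ha n q, eps_swap, C_mul, mul_assoc]
  have hB : ∑ n, ∑ β, ∑ γ, C (a q n * eps l β γ) * totalDeriv ℝ (Fin N × Fin 3) γ (aVar N n β)
      = ∑ n, C (a q n) * ∑ β, ∑ γ, C (eps l β γ) *
          totalDeriv ℝ (Fin N × Fin 3) γ (aVar N n β) := by
    simp only [Finset.mul_sum, C_mul, mul_assoc]
  have hC : ∑ p, ∑ s, ∑ β, ∑ γ, C (eps l β γ * lowK N c a q p s) * (aVar N p β * aVar N s γ)
      = ∑ n, C (a q n) * ∑ β, ∑ γ, C (eps l β γ) *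
          ∑ p, ∑ s, C (c n p s) * (aVar N p β * aVar N s γ) := by
    simp only [Finset.mul_sum, lowK, map_sum, Finset.sum_mul]
    have e : ∀ n β γ p s, (C (a q n) * (C (eps l β γ) *
        (C (c n p s) * (aVar N p β * aVar N s γ))))
        = C (eps l β γ * (a q n * c n p s)) * (aVar N p β * aVar N s γ) := by
      intro n β γ p s
      simp only [C_mul]; ring
    simp only [e]
    exact sum_reorder (fun n β γ p s => C (eps l β γ * (a q n * c n p s)) *
      (aVar N p β * aVar N s γ))
  rw [hA, hB, hC, ← Finset.sum_sub_distrib, ← Finset.sum_sub_distrib]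
  refine Finset.sum_congr rfl fun n _ => ?_
  rw [← mul_sub, ← mul_sub]
  refine congrArg₂ (· * ·) rfl ?_
  unfold calF
  have hD : ∑ β, ∑ γ, C (- eps l β γ) * totalDeriv ℝ (Fin N × Fin 3) γ (aVar N n β)
      = ∑ β, ∑ γ, C (eps l β γ) * totalDeriv ℝ (Fin N × Fin 3) β (aVar N n γ) := by
    rw [Finset.sum_comm]
    refine Finset.sum_congr rfl fun β _ => Finset.sum_congr rfl fun γ _ => ?_
    rw [eps_swap_right, neg_neg]
  rw [hD]
  simp only [mul_sub, Finset.sum_sub_distrib]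
  ring
end

/-- The contraction of the field strength with the Chern–Simons Euler–Lagrange
expressions vanishes identically: `∑_{r,λ} ℱ^r_{λμ} E^λ_r = 0`. -/
theorem calF_contract_ELCS (N : ℕ) (hN : 1 ≤ N)
    (c : Fin N → Fin N → Fin N → ℝ)
    (hc : ∀ r p q, c r p q = - c r q p)
    (hJacobi : ∀ p q t r,
      ∑ s, (c s p q * c r s t + c s q t * c r s p + c s t p * c r s q) = 0)
    (a : Fin N → Fin N → ℝ) (ha : ∀ m n', a m n' = a n' m)
    (hinv : ∀ p m n', ∑ s, (c s p m * a s n' + c s p n' * a m s) = 0)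
    (μ : Fin 3) :
    ∑ r, ∑ l, calF N c r l μ * ELCS N c a r l = 0 := by
  simp_rw [fun r l => ELCS_calF N c a r l hc ha hinv]
  exact contract_aux N a ha (calF N c) (calF_anti N c hc) μ
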